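/- arXiv:2404.08624 — 5 statements merged into one kernel-verified Lean document; each statement's English description precedes it below -/
import Mathlib

section
/- Let L : ℝ^m → ℝ be a nonnegative, differentiable, β-smooth function (β > 0), and let μ > 0 and constants a, b satisfy 0 < a ≤ b < min{1/β, 1/μ}. Suppose L satisfies the μ-PL* condition on the closed ball B(w₀, R), where R ≥ b·√(2β)·√(L(w₀)) / (1 − √(1 − aμ/2)). Let (w_t)_{t≥0} be any sequence with w_{t+1} = w_t − h_t·∇L(w_t) where the step sizes satisfy a ≤ h_t ≤ b for all t. Then for every t ≥ 0, w_t ∈ B(w₀, R) and L(w_t) ≤ L(w₀)·(1 − aμ/2)^t. -/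
open Metric
open scoped RealInnerProductSpace

/-- One gradient step of length `η` on a function with a quadratic upper bound. -/
theorem gradient_step_le {E : Type*} [NormedAddCommGroup E] [InnerProductSpace ℝ E]
    [CompleteSpace E] {L : E → ℝ} {β : ℝ}
    (hsmooth : ∀ x y, L y ≤ L x + ⟪gradient L x, y - x⟫ + β / 2 * ‖y - x‖ ^ 2)
    (x : E) (η : ℝ) :
    L (x - η • gradient L x) ≤ L x - η * (1 - β * η / 2) * ‖gradient L x‖ ^ 2 := by
  have key := hsmooth x (x - η • gradient L x)
  rw [sub_sub_cancel_left, inner_neg_right, inner_smul_right, real_inner_self_eq_norm_sq,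
    norm_neg, norm_smul, mul_pow, Real.norm_eq_abs, sq_abs] at key
  linarith

/-- A nonnegative `β`-smooth function satisfies `‖∇L‖² ≤ 2βL`. -/
theorem norm_gradient_sq_le {E : Type*} [NormedAddCommGroup E] [InnerProductSpace ℝ E]
    [CompleteSpace E] {L : E → ℝ} {β : ℝ} (hβ : 0 < β) (hL0 : ∀ x, 0 ≤ L x)
    (hsmooth : ∀ x y, L y ≤ L x + ⟪gradient L x, y - x⟫ + β / 2 * ‖y - x‖ ^ 2) (x : E) :
    ‖gradient L x‖ ^ 2 ≤ 2 * β * L x := by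
  have key := (hL0 _).trans (gradient_step_le hsmooth x (1 / β))
  have hη : 1 / β * (1 - β * (1 / β) / 2) = 1 / (2 * β) := by
    field_simp
    norm_num
  rw [hη, sub_nonneg, one_div_mul_eq_div, div_le_iff₀ (by positivity)] at key
  linarith

/-- For a nonnegative, differentiable, β-smooth function `L` satisfying the
μ-PL* condition on the closed ball `B(w₀, R)`, any first-order iteration
`w (t+1) = w t − h t • ∇L (w t)` with step sizes `a ≤ h t ≤ b < min (1/β) (1/μ)`
stays in `B(w₀, R)` and satisfies `L (w t) ≤ L w₀ * (1 − aμ/2)^t`. -/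
theorem pl_star_adaptive_stepsize_convergence {m : ℕ}
    (L : EuclideanSpace ℝ (Fin m) → ℝ) (β μ a b R : ℝ)
    (hβ : 0 < β) (hμ : 0 < μ)
    (hL0 : ∀ x, 0 ≤ L x) (hdiff : Differentiable ℝ L)
    (hsmooth : ∀ x y, L y ≤ L x + ⟪gradient L x, y - x⟫ + β / 2 * ‖y - x‖ ^ 2)
    (ha : 0 < a) (hab : a ≤ b) (hb : b < min (1 / β) (1 / μ))
    (w₀ : EuclideanSpace ℝ (Fin m))
    (hR : b * Real.sqrt (2 * β) * Real.sqrt (L w₀) / (1 - Real.sqrt (1 - a * μ / 2)) ≤ R)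
    (hPL : ∀ w ∈ closedBall w₀ R, μ * L w ≤ ‖gradient L w‖ ^ 2)
    (w : ℕ → EuclideanSpace ℝ (Fin m)) (hw0 : w 0 = w₀)
    (h : ℕ → ℝ) (hstep : ∀ t, a ≤ h t ∧ h t ≤ b)
    (hupd : ∀ t, w (t + 1) = w t - h t • gradient L (w t)) :
    ∀ t, w t ∈ closedBall w₀ R ∧ L (w t) ≤ L w₀ * (1 - a * μ / 2) ^ t := by
  obtain ⟨hbβ, hbμ⟩ := lt_min_iff.mp hb
  rw [lt_div_iff₀ hβ] at hbβ
  rw [lt_div_iff₀ hμ] at hbμ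
  have hb0 : 0 < b := ha.trans_le hab
  have haμ : a * μ < 1 := (mul_le_mul_of_nonneg_right hab hμ.le).trans_lt hbμ
  have haμ0 : 0 < a * μ := mul_pos ha hμ
  have hc : 0 ≤ 1 - a * μ / 2 := by linarith
  set q := Real.sqrt (1 - a * μ / 2) with hq
  have hq0 : 0 ≤ q := Real.sqrt_nonneg _
  have hqsq : q ^ 2 = 1 - a * μ / 2 := Real.sq_sqrt hc
  have hq1 : q < 1 := by nlinarith
  have hq1' : 0 < 1 - q := sub_pos.mpr hq1
  set K := b * Real.sqrt (2 * β) * Real.sqrt (L w₀) with hK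
  have hK0 : 0 ≤ K := by positivity
  have hball : ∀ t, ‖w t - w₀‖ ≤ K * (1 - q ^ t) / (1 - q) → w t ∈ closedBall w₀ R := by
    intro t ht
    rw [mem_closedBall, dist_eq_norm]
    refine ht.trans (le_trans ?_ hR)
    gcongr
    exact mul_le_of_le_one_right hK0 (sub_le_self _ (pow_nonneg hq0 t))
  have hinv : ∀ t, ‖w t - w₀‖ ≤ K * (1 - q ^ t) / (1 - q) ∧
      L (w t) ≤ L w₀ * (1 - a * μ / 2) ^ t := by
    intro t
    induction t with
    | zero => simp [hw0]
    | succ t ih =>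
      obtain ⟨hd, hL⟩ := ih
      obtain ⟨hat, hbt⟩ := hstep t
      have ht0 : 0 < h t := ha.trans_le hat
      constructor
      · have hgrad : ‖gradient L (w t)‖ ≤ Real.sqrt (2 * β) * Real.sqrt (L w₀) * q ^ t := by
          refine abs_le_of_sq_le_sq' ?_ (by positivity) |>.2
          rw [mul_pow, mul_pow, Real.sq_sqrt (by positivity), Real.sq_sqrt (hL0 _), ← pow_mul,
            mul_comm t 2, pow_mul, hqsq, mul_assoc]
          exact (norm_gradient_sq_le hβ hL0 hsmooth _).trans
            (mul_le_mul_of_nonneg_left hL (by positivity))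
        have hlen : ‖h t • gradient L (w t)‖ ≤ K * q ^ t := by
          rw [norm_smul, Real.norm_of_nonneg ht0.le]
          calc h t * ‖gradient L (w t)‖
              ≤ b * (Real.sqrt (2 * β) * Real.sqrt (L w₀) * q ^ t) := by gcongr
            _ = K * q ^ t := by rw [hK]; ring
        calc ‖w (t + 1) - w₀‖ = ‖(w t - w₀) - h t • gradient L (w t)‖ := by
              rw [hupd, sub_right_comm]
          _ ≤ ‖w t - w₀‖ + ‖h t • gradient L (w t)‖ := norm_sub_le _ _
          _ ≤ K * (1 - q ^ t) / (1 - q) + K * q ^ t := add_le_add hd hlen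
          _ = K * (1 - q ^ (t + 1)) / (1 - q) := by
              field_simp
              ring
      · have hpl := hPL _ (hball t hd)
        have hβt : β * h t ≤ 1 := by nlinarith
        have hdesc : a / 2 * (μ * L (w t)) ≤
            h t * (1 - β * h t / 2) * ‖gradient L (w t)‖ ^ 2 := by
          have hcoef : a / 2 ≤ h t * (1 - β * h t / 2) := by nlinarith
          have hμL : 0 ≤ μ * L (w t) := mul_nonneg hμ.le (hL0 _)
          exact mul_le_mul hcoef hpl hμL (le_trans (by positivity) hcoef)
        calc L (w (t + 1)) ≤ L (w t) - h t * (1 - β * h t / 2) * ‖gradient L (w t)‖ ^ 2 := by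
              rw [hupd]
              exact gradient_step_le hsmooth _ _
          _ ≤ L (w t) * (1 - a * μ / 2) := by linarith
          _ ≤ L w₀ * (1 - a * μ / 2) ^ t * (1 - a * μ / 2) :=
              mul_le_mul_of_nonneg_right hL hc
          _ = L w₀ * (1 - a * μ / 2) ^ (t + 1) := by rw [pow_succ, mul_assoc]
  exact fun t => ⟨hball t (hinv t).1, (hinv t).2⟩
end

section
/- Let L : ℝ^m → ℝ be a nonnegative, differentiable, β-smooth function (β > 0), let μ > 0 and constants a, b satisfy 0 < a ≤ b < min{1/β, 1/μ}, and suppose L satisfies the μ-PL* condition on the closed ball B(w₀, R), where R ≥ b·√(2β)·√(L(w₀)) / (1 − √(1 − aμ/2)). Let (w_t)_{t≥0} satisfy w_{t+1} = w_t − h_t·∇L(w_t) with a ≤ h_t ≤ b for all t. Then the sequence (w_t) converges to a point w* ∈ B(w₀, R) with L(w*) = 0; in particular w* is a global minimizer of L. -/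
open Metric Filter
open scoped RealInnerProductSpace

/-- A nonnegative function satisfying the quadratic upper bound has gradient bounded by
`√(2β) √(L x)`. -/
theorem norm_le_sqrt_of_nonneg_of_quadratic_upper_bound {E : Type*} [NormedAddCommGroup E]
    [InnerProductSpace ℝ E] {L : E → ℝ} {β : ℝ} (hβ : 0 < β) (hL0 : ∀ x, 0 ≤ L x) {x g : E}
    (hsmooth : ∀ y, L y ≤ L x + ⟪g, y - x⟫ + β / 2 * ‖y - x‖ ^ 2) :
    ‖g‖ ≤ √(2 * β) * √(L x) := by
  have h₁ := hsmooth (x - β⁻¹ • g)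
  have h₂ := hL0 (x - β⁻¹ • g)
  rw [sub_sub_cancel_left, norm_neg, inner_neg_right, inner_smul_right, norm_smul,
    Real.norm_eq_abs, mul_pow, sq_abs, real_inner_self_eq_norm_sq] at h₁
  have h₃ : β / 2 * (β⁻¹ ^ 2 * ‖g‖ ^ 2) = β⁻¹ * ‖g‖ ^ 2 / 2 := by field_simp
  have h₄ : β⁻¹ * ‖g‖ ^ 2 ≤ 2 * L x := by linarith
  rw [inv_mul_le_iff₀ hβ] at h₄
  rw [← Real.sqrt_mul (by positivity)]
  exact Real.le_sqrt_of_sq_le (by linarith)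

/-- A gradient step with step size `h ≤ 1 / β` decreases the function by at least
`h / 2 * ‖g‖ ^ 2`. -/
theorem le_sub_of_quadratic_upper_bound {E : Type*} [NormedAddCommGroup E]
    [InnerProductSpace ℝ E] {L : E → ℝ} {β h : ℝ} (h0 : 0 ≤ h) (hβ : β * h ≤ 1) {x g : E}
    (hsmooth : ∀ y, L y ≤ L x + ⟪g, y - x⟫ + β / 2 * ‖y - x‖ ^ 2) :
    L (x - h • g) ≤ L x - h / 2 * ‖g‖ ^ 2 := by
  have h₁ := hsmooth (x - h • g)
  rw [sub_sub_cancel_left, norm_neg, inner_neg_right, inner_smul_right, norm_smul,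
    Real.norm_eq_abs, mul_pow, sq_abs, real_inner_self_eq_norm_sq] at h₁
  have h₂ : β * h * (h * ‖g‖ ^ 2) ≤ 1 * (h * ‖g‖ ^ 2) := by gcongr
  linarith

/-- Under the same hypotheses as Lemma 1 (nonnegative, differentiable, β-smooth `L`
satisfying μ-PL* on `B(w₀, R)`, iterates `w (t+1) = w t − h t • ∇L (w t)` with
`0 < a ≤ h t ≤ b < min (1/β) (1/μ)`), the sequence converges to a point
`w* ∈ B(w₀, R)` with `L w* = 0`; in particular `w*` is a global minimizer of `L`. -/
theorem pl_star_adaptive_stepsize_converges_to_global_min {m : ℕ}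
    (L : EuclideanSpace ℝ (Fin m) → ℝ) (β μ a b R : ℝ)
    (hβ : 0 < β) (hμ : 0 < μ)
    (hL0 : ∀ x, 0 ≤ L x) (hdiff : Differentiable ℝ L)
    (hsmooth : ∀ x y, L y ≤ L x + ⟪gradient L x, y - x⟫ + β / 2 * ‖y - x‖ ^ 2)
    (ha : 0 < a) (hab : a ≤ b) (hb : b < min (1 / β) (1 / μ))
    (w₀ : EuclideanSpace ℝ (Fin m))
    (hR : b * Real.sqrt (2 * β) * Real.sqrt (L w₀) / (1 - Real.sqrt (1 - a * μ / 2)) ≤ R)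
    (hPL : ∀ w ∈ closedBall w₀ R, μ * L w ≤ ‖gradient L w‖ ^ 2)
    (w : ℕ → EuclideanSpace ℝ (Fin m)) (hw0 : w 0 = w₀)
    (h : ℕ → ℝ) (hstep : ∀ t, a ≤ h t ∧ h t ≤ b)
    (hupd : ∀ t, w (t + 1) = w t - h t • gradient L (w t)) :
    ∃ wstar ∈ closedBall w₀ R, Tendsto w atTop (nhds wstar) ∧ L wstar = 0 ∧
      ∀ v, L wstar ≤ L v := by
  have hb0 : 0 < b := ha.trans_le hab
  have hbβ : β * b < 1 := by
    have := hb.trans_le (min_le_left _ _)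
    rwa [lt_div_iff₀ hβ, mul_comm] at this
  have hbμ : b * μ < 1 := by
    have := hb.trans_le (min_le_right _ _)
    rwa [lt_div_iff₀ hμ] at this
  have haμ : a * μ < 1 := (mul_le_mul_of_nonneg_right hab hμ.le).trans_lt hbμ
  have haμ0 : 0 < a * μ := mul_pos ha hμ
  set q := √(1 - a * μ / 2) with hq
  have hq0 : 0 ≤ q := Real.sqrt_nonneg _
  have hq1 : q < 1 := (Real.sqrt_lt' one_pos).2 (by linarith)
  have hq1' : 0 < 1 - q := sub_pos.2 hq1
  set C := b * √(2 * β) * √(L w₀) with hC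
  have hC0 : 0 ≤ C := by positivity
  rw [div_le_iff₀ hq1'] at hR
  have hdist : ∀ t, dist (w t) (w (t + 1)) ≤ b * √(2 * β) * √(L (w t)) := by
    intro t
    have hg := norm_le_sqrt_of_nonneg_of_quadratic_upper_bound hβ hL0 (hsmooth (w t))
    rw [hupd t, dist_eq_norm, sub_sub_cancel, norm_smul, Real.norm_eq_abs,
      abs_of_nonneg (ha.le.trans (hstep t).1), mul_assoc]
    exact mul_le_mul (hstep t).2 hg (norm_nonneg _) hb0.le
  have hdecay : ∀ t, w t ∈ closedBall w₀ R → √(L (w (t + 1))) ≤ q * √(L (w t)) := by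
    intro t ht
    obtain ⟨hat, htb⟩ := hstep t
    have h0 : 0 ≤ h t := ha.le.trans hat
    have h₁ := le_sub_of_quadratic_upper_bound h0
      ((mul_le_mul_of_nonneg_left htb hβ.le).trans hbβ.le) (hsmooth (w t))
    have h₂ : a * (μ * L (w t)) ≤ h t * ‖gradient L (w t)‖ ^ 2 :=
      mul_le_mul hat (hPL _ ht) (mul_nonneg hμ.le (hL0 _)) h0
    rw [hq, ← Real.sqrt_mul (by linarith), hupd t]
    exact Real.sqrt_le_sqrt (by linarith)
  have hball : ∀ t, (1 - q) * dist (w t) w₀ ≤ C * (1 - q ^ t) → w t ∈ closedBall w₀ R := by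
    intro t ht
    have : C * (1 - q ^ t) ≤ C := mul_le_of_le_one_right hC0 (by linarith [pow_nonneg hq0 t])
    rw [mem_closedBall]
    exact le_of_mul_le_mul_left (by linarith) hq1'
  have hinv : ∀ t, √(L (w t)) ≤ q ^ t * √(L w₀) ∧
      (1 - q) * dist (w t) w₀ ≤ C * (1 - q ^ t) := by
    intro t
    induction t with
    | zero => simp [hw0]
    | succ t ih =>
      obtain ⟨ih₁, ih₂⟩ := ih
      refine ⟨?_, ?_⟩
      · calc √(L (w (t + 1))) ≤ q * √(L (w t)) := hdecay t (hball t ih₂)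
          _ ≤ q * (q ^ t * √(L w₀)) := by gcongr
          _ = q ^ (t + 1) * √(L w₀) := by ring
      · have h₁ : dist (w (t + 1)) w₀ ≤ b * √(2 * β) * (q ^ t * √(L w₀)) + dist (w t) w₀ := by
          calc dist (w (t + 1)) w₀ ≤ dist (w (t + 1)) (w t) + dist (w t) w₀ :=
                dist_triangle _ _ _
            _ ≤ b * √(2 * β) * √(L (w t)) + dist (w t) w₀ := by
                rw [dist_comm (w (t + 1))]
                gcongr
                exact hdist t
            _ ≤ _ := by gcongr
        calc (1 - q) * dist (w (t + 1)) w₀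
            ≤ (1 - q) * (b * √(2 * β) * (q ^ t * √(L w₀)) + dist (w t) w₀) := by gcongr
          _ = (1 - q) * (C * q ^ t) + (1 - q) * dist (w t) w₀ := by rw [hC]; ring
          _ ≤ (1 - q) * (C * q ^ t) + C * (1 - q ^ t) := by gcongr
          _ = C * (1 - q ^ (t + 1)) := by ring
  have hcauchy : CauchySeq w := cauchySeq_of_le_geometric q C hq1 fun t => by
    calc dist (w t) (w (t + 1)) ≤ b * √(2 * β) * √(L (w t)) := hdist t
      _ ≤ b * √(2 * β) * (q ^ t * √(L w₀)) := by gcongr; exact (hinv t).1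
      _ = C * q ^ t := by rw [hC]; ring
  obtain ⟨wstar, hlim⟩ := cauchySeq_tendsto_of_complete hcauchy
  have hzero : Tendsto (fun t => √(L (w t))) atTop (nhds 0) := by
    refine squeeze_zero (fun t => Real.sqrt_nonneg _) (fun t => (hinv t).1) ?_
    simpa using (tendsto_pow_atTop_nhds_zero_of_lt_one hq0 hq1).mul_const √(L w₀)
  have hLstar : L wstar = 0 := by
    have hcont := (hdiff.continuous.sqrt.tendsto wstar).comp hlim
    exact (Real.sqrt_eq_zero (hL0 _)).1 (tendsto_nhds_unique hcont hzero)
  exact ⟨wstar, isClosed_closedBall.mem_of_tendsto hlim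
    (Eventually.of_forall fun t => hball t (hinv t).2), hlim, hLstar, fun v => hLstar ▸ hL0 v⟩
end

section
/- Let (Ω, F, P) be a probability space, let L : ℝ^m → ℝ be nonnegative, differentiable and β-smooth (β > 0), and let θ > 0, γ > 0. Fix ε > 0 and set ε' = ε/θ. Assume δ satisfies (1 + ε'²)/(1 + 3ε'²) < δ < 1 and 0 < η < (δ(1 + 3ε'²) − (1 + ε'²)) / (2β(1 + ε'²)). Let (F_t)_{t≥1} be a filtration, let w₁ ∈ ℝ^m be deterministic, and let (w_t)_{t≥1}, (g_t)_{t≥1} be random sequences such that: w_t is F_t-measurable, g_t is F_{t+1}-measurable and integrable, the conditional expectation satisfies E[g_t | F_t] = ∇L(w_t) almost surely, ‖g_t − ∇L(w_t)‖ ≤ θ almost surely, ‖∇L(w_t)‖ is square-integrable for each t, and w_{t+1} = w_t − h(g_t)·g_t with h(g) = η·min{1, max{δ, γ/‖g‖}} (and h(g) = η when g = 0). Then for every positive integer T: min_{t=1,…,T} E[‖∇L(w_t)‖²] ≤ ε² + (1/T)·L(w₁) / (η(3δ − 1)/2 − βη²). -/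
open MeasureTheory
open scoped RealInnerProductSpace Classical

/-- The δ-GClip step size `h(g) = η · min {1, max {δ, γ/‖g‖}}`, with the convention
that it equals `η` when `g = 0`. -/
noncomputable def deltaGClipStep {m : ℕ} (η γ δ : ℝ) (g : EuclideanSpace ℝ (Fin m)) : ℝ :=
  if g = 0 then η else η * min 1 (max δ (γ / ‖g‖))

lemma deltaGClipStep_le {m : ℕ} {η γ δ : ℝ} (hη : 0 ≤ η) (g : EuclideanSpace ℝ (Fin m)) :
    deltaGClipStep η γ δ g ≤ η := by
  unfold deltaGClipStep
  split_ifs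
  · exact le_rfl
  · exact mul_le_of_le_one_right hη (min_le_left _ _)

lemma le_deltaGClipStep {m : ℕ} {η γ δ : ℝ} (hη : 0 ≤ η) (hδ : δ ≤ 1)
    (g : EuclideanSpace ℝ (Fin m)) : η * δ ≤ deltaGClipStep η γ δ g := by
  unfold deltaGClipStep
  split_ifs
  · exact mul_le_of_le_one_right hη hδ
  · exact mul_le_mul_of_nonneg_left (le_min hδ (le_max_left _ _)) hη

/-- The descent inequality for a smooth function under any step size between `η * δ` and `η`,
with a gradient estimate of error at most `θ`. -/
lemma descent_of_step_mem_Icc {E : Type*} [NormedAddCommGroup E] [InnerProductSpace ℝ E]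
    {l l' β θ δ η h : ℝ} {G g : E} (hβ : 0 ≤ β) (hη : 0 ≤ η) (hδ0 : 0 ≤ δ) (hδ1 : δ ≤ 1)
    (hh : h ≤ η) (hh' : η * δ ≤ h) (hg : ‖g - G‖ ≤ θ)
    (hl : l' ≤ l + ⟪G, -(h • g)⟫ + β / 2 * ‖-(h • g)‖ ^ 2) :
    l' ≤ l - (η * δ - β * η ^ 2 / 2) * ‖G‖ ^ 2 + (β * η ^ 2 - η * δ) * ⟪G, g - G⟫
      + θ ^ 2 * (η * (1 - δ) / 2 + β * η ^ 2 / 2) := by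
  have hh0 : 0 ≤ h := (mul_nonneg hη hδ0).trans hh'
  have hnorm : ‖-(h • g)‖ ^ 2 = h ^ 2 * ‖g‖ ^ 2 := by
    rw [norm_neg, norm_smul, mul_pow, Real.norm_eq_abs, sq_abs]
  rw [hnorm, inner_neg_right, real_inner_smul_right] at hl
  have hinner : ⟪G, g⟫ = ‖G‖ ^ 2 + ⟪G, g - G⟫ := by
    rw [inner_sub_right, real_inner_self_eq_norm_sq]; ring
  have hsq : ‖g‖ ^ 2 = ‖G‖ ^ 2 + 2 * ⟪G, g - G⟫ + ‖g - G‖ ^ 2 := by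
    rw [← norm_add_sq_real, add_sub_cancel]
  have hn : ‖g - G‖ ^ 2 ≤ θ ^ 2 := by gcongr
  have hstep : h ^ 2 ≤ η ^ 2 := by gcongr
  have hcross : (η - h) * ⟪G, g⟫ ≤ η * (1 - δ) * ((‖G‖ ^ 2 + ‖g‖ ^ 2) / 2) := by
    have hle : ⟪G, g⟫ ≤ (‖G‖ ^ 2 + ‖g‖ ^ 2) / 2 := by
      nlinarith [real_inner_le_norm G g, sq_nonneg (‖G‖ - ‖g‖)]
    calc (η - h) * ⟪G, g⟫ ≤ (η - h) * ((‖G‖ ^ 2 + ‖g‖ ^ 2) / 2) :=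
          mul_le_mul_of_nonneg_left hle (by linarith)
      _ ≤ η * (1 - δ) * ((‖G‖ ^ 2 + ‖g‖ ^ 2) / 2) :=
          mul_le_mul_of_nonneg_right (by linarith) (by positivity)
  have hquad : β / 2 * (h ^ 2 * ‖g‖ ^ 2) ≤ β / 2 * (η ^ 2 * ‖g‖ ^ 2) := by gcongr
  have hnoise := mul_le_mul_of_nonneg_left hn
    (show 0 ≤ η * (1 - δ) / 2 + β * η ^ 2 / 2 by
      have := mul_nonneg hη (sub_nonneg.2 hδ1)
      positivity)
  rw [hsq] at hcross hquad
  rw [hinner] at hcross hl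
  rw [hsq] at hl
  linarith

section CondExp

variable {Ω E : Type*} {m₀ mΩ : MeasurableSpace Ω} {P : Measure Ω}
  [NormedAddCommGroup E] [InnerProductSpace ℝ E] {G g : Ω → E}

lemma integrable_inner_sub_of_norm_sub_le [IsFiniteMeasure P] {θ : ℝ}
    (hG : AEStronglyMeasurable G P) (hg : AEStronglyMeasurable g P)
    (hsq : Integrable (fun ω => ‖G ω‖ ^ 2) P) (hnoise : ∀ᵐ ω ∂P, ‖g ω - G ω‖ ≤ θ) :
    Integrable (fun ω => ⟪G ω, g ω - G ω⟫) P := by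
  refine (hsq.add (integrable_const (θ ^ 2))).mono' (hG.inner (hg.sub hG)) ?_
  filter_upwards [hnoise] with ω hω
  have h₁ : ‖⟪G ω, g ω - G ω⟫‖ ≤ ‖G ω‖ * ‖g ω - G ω‖ := norm_inner_le_norm _ _
  have h₂ : ‖g ω - G ω‖ ^ 2 ≤ θ ^ 2 := by gcongr
  simp only [Pi.add_apply]
  nlinarith [sq_nonneg (‖G ω‖ - ‖g ω - G ω‖), sq_nonneg ‖G ω‖, sq_nonneg ‖g ω - G ω‖]

lemma integral_inner_sub_condExp_eq_zero [CompleteSpace E] [IsFiniteMeasure P]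
    (hm : m₀ ≤ mΩ) (hg : Integrable g P) (hG : P[g | m₀] =ᵐ[P] G)
    (hint : Integrable (fun ω => ⟪G ω, g ω - G ω⟫) P) :
    ∫ ω, ⟪G ω, g ω - G ω⟫ ∂P = 0 := by
  have hGint : Integrable G P := integrable_condExp.congr hG
  have hGm : AEStronglyMeasurable[m₀] G P :=
    stronglyMeasurable_condExp.aestronglyMeasurable.congr hG
  have hzero : P[g - G | m₀] =ᵐ[P] 0 := by
    have hGG : P[G | m₀] =ᵐ[P] G := condExp_of_aestronglyMeasurable' hm hGm hGint
    filter_upwards [condExp_sub hg hGint m₀, hG, hGG] with ω h₁ h₂ h₃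
    rw [h₁, Pi.sub_apply, h₂, h₃, sub_self, Pi.zero_apply]
  have hpull := condExp_bilin_of_aestronglyMeasurable_left (innerSL ℝ) hGm
    (g := g - G) hint (hg.sub hGint)
  rw [← integral_condExp hm]
  refine integral_eq_zero_of_ae ?_
  filter_upwards [hpull, hzero] with ω h₁ h₂
  exact h₁.trans (by rw [h₂]; simp)

end CondExp

/-- The conditions on `δ` and `η` make the noise term in the descent inequality at most `ε ^ 2`
times the coefficient appearing in the convergence rate. -/
lemma noise_le_mul_rate {β θ ε δ η : ℝ} (hβ : 0 < β) (hθ : 0 < θ) (hη : 0 < η)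
    (hηub : η < (δ * (1 + 3 * (ε / θ) ^ 2) - (1 + (ε / θ) ^ 2)) / (2 * β * (1 + (ε / θ) ^ 2))) :
    θ ^ 2 * (η * (1 - δ) / 2 + β * η ^ 2 / 2) ≤ ε ^ 2 * (η * (3 * δ - 1) / 2 - β * η ^ 2) := by
  obtain ⟨r, rfl⟩ : ∃ r, ε = r * θ := ⟨ε / θ, by field_simp⟩
  rw [mul_div_cancel_right₀ r hθ.ne', lt_div_iff₀ (by positivity)] at hηub
  have key : η * (1 - δ) / 2 + β * η ^ 2 / 2 ≤ r ^ 2 * (η * (3 * δ - 1) / 2 - β * η ^ 2) := by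
    have h₀ : (1 - δ) + β * η ≤ r ^ 2 * (3 * δ - 1 - 2 * β * η) := by
      nlinarith [mul_pos hβ hη]
    nlinarith [mul_le_mul_of_nonneg_left h₀ hη.le]
  calc _ ≤ θ ^ 2 * (r ^ 2 * (η * (3 * δ - 1) / 2 - β * η ^ 2)) := by gcongr
    _ = _ := by ring

/-- convergence of stochastic δ-GClip.  Under the bounded-noise, unbiased
gradient oracle assumptions, with `(1+ε'²)/(1+3ε'²) < δ < 1` and
`0 < η < (δ(1+3ε'²) − (1+ε'²)) / (2β(1+ε'²))` where `ε' = ε/θ`, for every `T ≥ 1` one has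
`min_{t=1..T} E[‖∇L(w_t)‖²] ≤ ε² + (1/T)·L(w₁) / (η(3δ−1)/2 − βη²)`. -/
theorem stochastic_deltaGClip_convergence {m : ℕ}
    {Ω : Type*} {mΩ : MeasurableSpace Ω} (P : Measure Ω) [IsProbabilityMeasure P]
    (L : EuclideanSpace ℝ (Fin m) → ℝ) (β θ γ ε δ η : ℝ)
    (hβ : 0 < β) (hθ : 0 < θ) (hγ : 0 < γ) (hε : 0 < ε)
    (hL0 : ∀ x, 0 ≤ L x) (hdiff : Differentiable ℝ L)
    (hsmooth : ∀ x y, L y ≤ L x + ⟪gradient L x, y - x⟫ + β / 2 * ‖y - x‖ ^ 2)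
    (hδlow : (1 + (ε / θ) ^ 2) / (1 + 3 * (ε / θ) ^ 2) < δ) (hδ1 : δ < 1)
    (hη0 : 0 < η)
    (hηub : η < (δ * (1 + 3 * (ε / θ) ^ 2) - (1 + (ε / θ) ^ 2)) / (2 * β * (1 + (ε / θ) ^ 2)))
    (ℱ : Filtration ℕ mΩ)
    (w₁ : EuclideanSpace ℝ (Fin m))
    (w g : ℕ → Ω → EuclideanSpace ℝ (Fin m))
    (hw1 : w 1 = fun _ => w₁)
    (hwmeas : ∀ t, StronglyMeasurable[ℱ t] (w t))
    (hgmeas : ∀ t, StronglyMeasurable[ℱ (t + 1)] (g t))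
    (hgint : ∀ t, Integrable (g t) P)
    (hunbiased : ∀ t, P[g t | ℱ t] =ᵐ[P] fun ω => gradient L (w t ω))
    (hnoise : ∀ t, ∀ᵐ ω ∂P, ‖g t ω - gradient L (w t ω)‖ ≤ θ)
    (hsqint : ∀ t, Integrable (fun ω => ‖gradient L (w t ω)‖ ^ 2) P)
    (hupd : ∀ t, 1 ≤ t →
      w (t + 1) = fun ω => w t ω - deltaGClipStep η γ δ (g t ω) • g t ω) :
    ∀ T : ℕ, 1 ≤ T → ∃ t, 1 ≤ t ∧ t ≤ T ∧
      ∫ ω, ‖gradient L (w t ω)‖ ^ 2 ∂P ≤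
        ε ^ 2 + (1 / (T : ℝ)) * L w₁ / (η * (3 * δ - 1) / 2 - β * η ^ 2) := by
  have hδ0 : 0 < δ := lt_trans (by positivity) hδlow
  have hnoise_le := noise_le_mul_rate hβ hθ hη0 hηub
  set c := η * (3 * δ - 1) / 2 - β * η ^ 2 with hc
  have hk : 0 < η * (1 - δ) / 2 + β * η ^ 2 / 2 := by
    have := mul_pos hη0 (sub_pos.2 hδ1)
    positivity
  have hcpos : 0 < c := by
    have : 0 < ε ^ 2 * c := lt_of_lt_of_le (by positivity) hnoise_le
    exact pos_of_mul_pos_right this (by positivity)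
  have hgm (t : ℕ) : AEStronglyMeasurable (g t) P := (hgint t).aestronglyMeasurable
  have hGm (t : ℕ) : AEStronglyMeasurable (fun ω => gradient L (w t ω)) P :=
    (integrable_condExp.congr (hunbiased t)).aestronglyMeasurable
  have hinner (t : ℕ) := integrable_inner_sub_of_norm_sub_le (hGm t) (hgm t) (hsqint t) (hnoise t)
  have hinner0 (t : ℕ) :=
    integral_inner_sub_condExp_eq_zero (ℱ.le t) (hgint t) (hunbiased t) (hinner t)
  have hLm (t : ℕ) : AEStronglyMeasurable (fun ω => L (w t ω)) P :=
    (hdiff.continuous.comp_stronglyMeasurable ((hwmeas t).mono (ℱ.le t))).aestronglyMeasurable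
  have hdescent (t : ℕ) (ht : 1 ≤ t) : ∀ᵐ ω ∂P, L (w (t + 1) ω) ≤
      L (w t ω) - (η * δ - β * η ^ 2 / 2) * ‖gradient L (w t ω)‖ ^ 2
        + (β * η ^ 2 - η * δ) * ⟪gradient L (w t ω), g t ω - gradient L (w t ω)⟫
        + θ ^ 2 * (η * (1 - δ) / 2 + β * η ^ 2 / 2) := by
    filter_upwards [hnoise t] with ω hω
    have hs := hsmooth (w t ω) (w (t + 1) ω)
    have hsub : w (t + 1) ω - w t ω = -(deltaGClipStep η γ δ (g t ω) • g t ω) := by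
      rw [hupd t ht, sub_sub_cancel_left]
    rw [hsub] at hs
    exact descent_of_step_mem_Icc hβ.le hη0.le hδ0.le hδ1.le (deltaGClipStep_le hη0.le _)
      (le_deltaGClipStep hη0.le hδ1.le _) hω hs
  have hbound_int (t : ℕ) (hLt : Integrable (fun ω => L (w t ω)) P) :=
    ((hLt.sub ((hsqint t).const_mul (η * δ - β * η ^ 2 / 2))).add
      ((hinner t).const_mul (β * η ^ 2 - η * δ))).add
      (integrable_const (θ ^ 2 * (η * (1 - δ) / 2 + β * η ^ 2 / 2)))
  have hLint (t : ℕ) (ht : 1 ≤ t) : Integrable (fun ω => L (w t ω)) P := by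
    induction t, ht using Nat.le_induction with
    | base => simp [hw1]
    | succ t ht ih =>
      refine (hbound_int t ih).mono' (hLm _) ?_
      filter_upwards [hdescent t ht] with ω hω
      rw [Real.norm_of_nonneg (hL0 _)]
      exact hω
  have hstep (t : ℕ) (ht : 1 ≤ t) : ∫ ω, L (w (t + 1) ω) ∂P ≤
      ∫ ω, L (w t ω) ∂P - c * (∫ ω, ‖gradient L (w t ω)‖ ^ 2 ∂P - ε ^ 2) := by
    have h := integral_mono_ae (hLint (t + 1) (by omega)) (hbound_int t (hLint t ht))
      (hdescent t ht)
    have hLt := hLint t ht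
    have hS := (hsqint t).const_mul (η * δ - β * η ^ 2 / 2)
    have hI := (hinner t).const_mul (β * η ^ 2 - η * δ)
    rw [integral_add' ((hLt.sub hS).add hI) (integrable_const _), integral_add' (hLt.sub hS) hI,
      integral_sub' hLt hS, integral_const_mul, integral_const_mul, hinner0 t, integral_const,
      probReal_univ, one_smul, mul_zero, add_zero] at h
    have hS0 : 0 ≤ ∫ ω, ‖gradient L (w t ω)‖ ^ 2 ∂P := integral_nonneg fun _ => by positivity
    have hcoef : c ≤ η * δ - β * η ^ 2 / 2 := by rw [hc]; linarith
    have := mul_le_mul_of_nonneg_right hcoef hS0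
    linarith
  intro T hT
  by_contra! hcon
  have hT0 : (0 : ℝ) < T := by exact_mod_cast hT
  have hsum (k : ℕ) (hk : 1 ≤ k) (hkT : k ≤ T) :
      ∫ ω, L (w (k + 1) ω) ∂P < L w₁ - k * (L w₁ / T) := by
    have hdrop (t : ℕ) (ht : 1 ≤ t) (htT : t ≤ T) :
        ∫ ω, L (w (t + 1) ω) ∂P < ∫ ω, L (w t ω) ∂P - L w₁ / T := by
      have h := mul_lt_mul_of_pos_left (hcon t ht htT) hcpos
      have heq : c * (ε ^ 2 + 1 / (T : ℝ) * L w₁ / c) = c * ε ^ 2 + L w₁ / T := by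
        field_simp
      have := hstep t ht
      linarith
    induction k, hk using Nat.le_induction with
    | base =>
      have h := hdrop 1 le_rfl hT
      simpa [hw1] using h
    | succ k hk ih =>
      have h := hdrop (k + 1) (by omega) hkT
      have := ih (by omega)
      push_cast
      linarith
  have hfinal := hsum T hT le_rfl
  rw [mul_div_cancel₀ _ hT0.ne', sub_self] at hfinal
  exact hfinal.not_ge (integral_nonneg fun _ => hL0 _)
end

section
/- Let ε' > 0 and β > 0, and suppose δ satisfies (1 + ε'²)/(1 + 3ε'²) < δ < 1 and η satisfies 0 < η < (δ(1 + 3ε'²) − (1 + ε'²)) / (2β(1 + ε'²)). Then η(3δ − 1) − 2βη² > 0 and (η(1 − δ) + 2βη²) / (η(3δ − 1) − 2βη²) < ε'². -/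
/-- the hyperparameter range computation for stochastic δ-GClip.
If `(1+ε'²)/(1+3ε'²) < δ < 1` and `0 < η < (δ(1+3ε'²) − (1+ε'²)) / (2β(1+ε'²))`, then
`η(3δ−1) − 2βη² > 0` and `(η(1−δ) + 2βη²) / (η(3δ−1) − 2βη²) < ε'²`. -/
theorem deltaGClip_hyperparameter_range (ε' β δ η : ℝ)
    (hε' : 0 < ε') (hβ : 0 < β)
    (hδlow : (1 + ε' ^ 2) / (1 + 3 * ε' ^ 2) < δ) (hδ1 : δ < 1)
    (hη0 : 0 < η)
    (hηub : η < (δ * (1 + 3 * ε' ^ 2) - (1 + ε' ^ 2)) / (2 * β * (1 + ε' ^ 2))) :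
    0 < η * (3 * δ - 1) - 2 * β * η ^ 2 ∧
      (η * (1 - δ) + 2 * β * η ^ 2) / (η * (3 * δ - 1) - 2 * β * η ^ 2) < ε' ^ 2 := by
  have hε : 0 < ε' ^ 2 := by positivity
  have hδ0 : 0 < δ := lt_trans (by positivity) hδlow
  rw [lt_div_iff₀ (by positivity)] at hηub
  have hfactor : 0 < 3 * δ - 1 - 2 * β * η := by
    refine pos_of_mul_pos_right (a := 1 + ε' ^ 2) ?_ (by positivity)
    linarith
  have hden : 0 < η * (3 * δ - 1) - 2 * β * η ^ 2 := by
    linarith [mul_pos hη0 hfactor]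
  refine ⟨hden, ?_⟩
  rw [div_lt_iff₀ hden]
  linarith [mul_lt_mul_of_pos_left hηub hη0]
end

section
/- Let L : ℝ^m → ℝ be a nonnegative, differentiable, β-smooth function (β > 0), let μ > 0, and let w ∈ ℝ^m satisfy the μ-PL* inequality ‖∇L(w)‖² ≥ μ·L(w). If 0 < h < 1/β and w' = w − h·∇L(w), then L(w') ≤ (1 − hμ/2)·L(w). -/
open scoped RealInnerProductSpace

/-- one-step descent under the PL* inequality.  If `L` is nonnegative,
differentiable and β-smooth, `w` satisfies `‖∇L(w)‖² ≥ μ L(w)`, and `0 < h < 1/β`, then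
the gradient step `w' = w − h • ∇L(w)` satisfies `L(w') ≤ (1 − hμ/2) L(w)`. -/
theorem pl_star_one_step_descent {m : ℕ}
    (L : EuclideanSpace ℝ (Fin m) → ℝ) (β μ h : ℝ)
    (hβ : 0 < β) (hμ : 0 < μ)
    (hL0 : ∀ x, 0 ≤ L x) (hdiff : Differentiable ℝ L)
    (hsmooth : ∀ x y, L y ≤ L x + ⟪gradient L x, y - x⟫ + β / 2 * ‖y - x‖ ^ 2)
    (w : EuclideanSpace ℝ (Fin m))
    (hPL : μ * L w ≤ ‖gradient L w‖ ^ 2)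
    (hh0 : 0 < h) (hh : h < 1 / β) :
    L (w - h • gradient L w) ≤ (1 - h * μ / 2) * L w := by
  have hβh : h * β < 1 := (lt_div_iff₀ hβ).mp hh
  have hstep := hsmooth w (w - h • gradient L w)
  rw [sub_sub_cancel_left, inner_neg_right, real_inner_smul_right, real_inner_self_eq_norm_sq,
    norm_neg, norm_smul, mul_pow, Real.norm_eq_abs, sq_abs] at hstep
  have hquad : 0 ≤ h * (1 - h * β) * ‖gradient L w‖ ^ 2 :=
    mul_nonneg (mul_nonneg hh0.le (sub_nonneg.mpr hβh.le)) (sq_nonneg _)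
  have hdescent := mul_le_mul_of_nonneg_left hPL hh0.le
  linarith
end
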